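/- Let (A,j) be a soft inductive system of C*-algebras over a directed set N, i.e. a soft inductive system of Banach spaces in which every A_n is a C*-algebra, every connecting map j_{nm} is a star-preserving linear contraction, and the asymptotic homomorphism property holds: lim_m limsup_n ‖j_{nm}((j_{ml} a_l)(j_{ml} b_l)) − (j_{nl} a_l)(j_{nl} b_l)‖ = 0 for all l ∈ N and a_l, b_l ∈ A_l. Then for any j-convergent nets a_• and b_•: the adjoint net a_•^* = (a_n^*)_{n∈N} is j-convergent, the product net a_• b_• = (a_n b_n)_{n∈N} is j-convergent, and the j-limits of a_•^* and a_• b_• depend only on the j-limits of a_• and b_• (i.e. replacing a_• or b_• by nets with the same j-limit does not change the j-limit of the adjoint or of the product). -/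

import Mathlib

open Filter Topology MeasureTheory

variable {N : Type*} [Preorder N] [IsDirected N (· ≤ ·)] [Nonempty N]
variable {E : N → Type*} [∀ n, NormedAddCommGroup (E n)] [∀ n, NormedSpace ℂ (E n)]
  [∀ n, CompleteSpace (E n)]

/-- A *soft inductive system* of Banach spaces over the directed set `N`:
linear contractions `j n m : E m → E n` (for `n ≥ m`, with `j n n = id` and
`j n m = 0` when `¬ m ≤ n`), satisfying
`lim_m limsup_n ‖(j n l - j n m ∘ j m l) x‖ = 0` for all `l` and `x : E l`. -/
structure IsSoftInductiveSystem (j : ∀ n m : N, E m →L[ℂ] E n) : Prop where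
  map_self : ∀ n, j n n = ContinuousLinearMap.id ℂ (E n)
  map_not_le : ∀ n m, ¬ m ≤ n → j n m = 0
  contraction : ∀ n m, m ≤ n → ∀ x : E m, ‖j n m x‖ ≤ ‖x‖
  soft : ∀ (l : N) (x : E l),
    Tendsto (fun m => limsup (fun n => ‖j n l x - j n m (j m l x)‖) atTop)
      atTop (𝓝 0)

/-- A net `x = (x n)_{n ∈ N}` (with `x n ∈ E n`) is uniformly bounded. -/
def UniformlyBounded (x : ∀ n, E n) : Prop := ∃ C : ℝ, ∀ n, ‖x n‖ ≤ C

/-- The seminorm `|‖x‖| = limsup_n ‖x n‖` on uniformly bounded nets. -/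
noncomputable def netSeminorm (x : ∀ n, E n) : ℝ := limsup (fun n => ‖x n‖) atTop

/-- The basic net `j_{• m} ξ` associated with `ξ ∈ E m`. -/
def basicNet (j : ∀ n m : N, E m →L[ℂ] E n) (m : N) (ξ : E m) : ∀ n, E n :=
  fun n => j n m ξ

/-- A uniformly bounded net is `j`-convergent if it lies in the seminorm-closure of
the set of basic nets. -/
def JConvergent (j : ∀ n m : N, E m →L[ℂ] E n) (x : ∀ n, E n) : Prop :=
  UniformlyBounded x ∧
    ∀ ε : ℝ, 0 < ε → ∃ (m : N) (ξ : E m), netSeminorm (fun n => x n - j n m ξ) < ε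

/-- A net is a null net if `lim_n ‖x n‖ = 0`. -/
def IsNullNet (x : ∀ n, E n) : Prop := Tendsto (fun n => ‖x n‖) atTop (𝓝 0)

/-- A realization `(G, L)` of the limit space `E_∞ = C(E,j)/C₀(E,j)` of a soft inductive
system: `L` sends a `j`-convergent net to its `j`-limit; it is linear on `j`-convergent
nets, the norm of a `j`-limit is the seminorm of the net, and every element of `G`
arises as a `j`-limit. -/
structure IsLimitSpace (j : ∀ n m : N, E m →L[ℂ] E n) (G : Type*)
    [NormedAddCommGroup G] [NormedSpace ℂ G] (L : (∀ n, E n) → G) : Prop where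
  map_add : ∀ x y, JConvergent j x → JConvergent j y → L (x + y) = L x + L y
  map_smul : ∀ (c : ℂ) (x), JConvergent j x → L (c • x) = c • L x
  norm_eq : ∀ x, JConvergent j x → ‖L x‖ = netSeminorm x
  surjective : ∀ g : G, ∃ x, JConvergent j x ∧ L x = g

set_option linter.unusedSectionVars false

/-- A bounded net with `limsup_n ‖x n‖ < ε` is eventually smaller than `ε`. -/
theorem eventually_norm_lt_of_limsup_lt {x : ∀ n, E n} {C ε : ℝ} (hC : ∀ n, ‖x n‖ ≤ C)
    (h : limsup (fun n => ‖x n‖) atTop < ε) : ∀ᶠ n in atTop, ‖x n‖ < ε :=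
  eventually_lt_of_limsup_lt h (isBoundedUnder_of ⟨C, hC⟩)

theorem netSeminorm_le_of_eventually_le {x : ∀ n, E n} {ε : ℝ}
    (h : ∀ᶠ n in atTop, ‖x n‖ ≤ ε) : netSeminorm x ≤ ε :=
  limsup_le_of_le (isCoboundedUnder_le_of_le atTop fun n => norm_nonneg (x n)) h

theorem IsSoftInductiveSystem.norm_map_le {j : ∀ n m : N, E m →L[ℂ] E n}
    (hj : IsSoftInductiveSystem j) (n m : N) (x : E m) : ‖j n m x‖ ≤ ‖x‖ := by
  by_cases h : m ≤ n
  · exact hj.contraction n m h x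
  · simp [hj.map_not_le n m h]

/-- A `j`-convergent net is approximated by basic nets eventually in norm. -/
theorem JConvergent.exists_eventually_norm_sub_lt {j : ∀ n m : N, E m →L[ℂ] E n}
    (hj : IsSoftInductiveSystem j) {x : ∀ n, E n} (hx : JConvergent j x) {ε : ℝ} (hε : 0 < ε) :
    ∃ (m : N) (ξ : E m), ∀ᶠ n in atTop, ‖x n - j n m ξ‖ < ε := by
  obtain ⟨⟨C, hC⟩, h⟩ := hx
  obtain ⟨m, ξ, hξ⟩ := h ε hε
  exact ⟨m, ξ, eventually_norm_lt_of_limsup_lt (C := C + ‖ξ‖)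
    (fun n => (norm_sub_le _ _).trans (add_le_add (hC n) (hj.norm_map_le n m ξ))) hξ⟩

/-- The index of the approximating basic net may be chosen arbitrarily large. -/
theorem JConvergent.eventually_exists_norm_sub_lt {j : ∀ n m : N, E m →L[ℂ] E n}
    (hj : IsSoftInductiveSystem j) {x : ∀ n, E n} (hx : JConvergent j x) {ε : ℝ} (hε : 0 < ε) :
    ∀ᶠ m in atTop, ∃ ξ : E m, ∀ᶠ n in atTop, ‖x n - j n m ξ‖ < ε := by
  obtain ⟨l, ξ, hξ⟩ := hx.exists_eventually_norm_sub_lt hj (half_pos hε)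
  filter_upwards [(hj.soft l ξ).eventually_lt_const (half_pos hε)] with m hm
  refine ⟨j m l ξ, ?_⟩
  have hbound : ∀ n, ‖j n l ξ - j n m (j m l ξ)‖ ≤ ‖ξ‖ + ‖ξ‖ := fun n =>
    (norm_sub_le _ _).trans (add_le_add (hj.norm_map_le n l ξ)
      ((hj.norm_map_le n m _).trans (hj.norm_map_le m l ξ)))
  filter_upwards [hξ, eventually_norm_lt_of_limsup_lt hbound hm] with n h₁ h₂
  have := norm_sub_le_norm_sub_add_norm_sub (x n) (j n l ξ) (j n m (j m l ξ))
  linarith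

theorem JConvergent.of_eventually {j : ∀ n m : N, E m →L[ℂ] E n} {x : ∀ n, E n}
    (hx : UniformlyBounded x)
    (h : ∀ ε : ℝ, 0 < ε → ∃ (m : N) (ξ : E m), ∀ᶠ n in atTop, ‖x n - j n m ξ‖ < ε) :
    JConvergent j x := by
  refine ⟨hx, fun ε hε => ?_⟩
  obtain ⟨m, ξ, hξ⟩ := h (ε / 2) (half_pos hε)
  exact ⟨m, ξ, (netSeminorm_le_of_eventually_le (hξ.mono fun _ => le_of_lt)).trans_lt
    (half_lt_self hε)⟩

theorem norm_mul_sub_mul_le {R : Type*} [NormedRing R] (a a' b b' : R) :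
    ‖a * b - a' * b'‖ ≤ ‖a - a'‖ * ‖b‖ + ‖a'‖ * ‖b - b'‖ := by
  have h : a * b - a' * b' = (a - a') * b + a' * (b - b') := by noncomm_ring
  rw [h]
  exact (norm_add_le _ _).trans (add_le_add (norm_mul_le _ _) (norm_mul_le _ _))

/-- Products of `j`-convergent nets are `j`-convergent when the connecting maps are
asymptotically multiplicative. -/
theorem JConvergent.mul {A : N → Type*} [∀ n, NormedRing (A n)] [∀ n, NormedAlgebra ℂ (A n)]
    [∀ n, CompleteSpace (A n)] {j : ∀ n m : N, A m →L[ℂ] A n} (hj : IsSoftInductiveSystem j)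
    (hmul : ∀ (l : N) (a b : A l),
      Tendsto (fun m => limsup
          (fun n => ‖j n m (j m l a * j m l b) - j n l a * j n l b‖) atTop)
        atTop (𝓝 0))
    {a b : ∀ n, A n} (ha : JConvergent j a) (hb : JConvergent j b) :
    JConvergent j (fun n => a n * b n) := by
  obtain ⟨C, hC⟩ := ha.1
  obtain ⟨D, hD⟩ := hb.1
  obtain ⟨n₀⟩ := ‹Nonempty N›
  have hC₀ : 0 ≤ C := (norm_nonneg _).trans (hC n₀)
  have hD₀ : 0 ≤ D := (norm_nonneg _).trans (hD n₀)
  refine .of_eventually ⟨C * D, fun n => (norm_mul_le _ _).trans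
    (mul_le_mul (hC n) (hD n) (norm_nonneg _) hC₀)⟩ fun ε hε => ?_
  obtain ⟨δ, hδ, hδ₁, hδε⟩ : ∃ δ : ℝ, 0 < δ ∧ δ ≤ 1 ∧ δ * (C + D + 2) ≤ ε := by
    refine ⟨min 1 (ε / (C + D + 2)), by positivity, min_le_left _ _, ?_⟩
    rw [← le_div_iff₀ (by positivity)]
    exact min_le_right _ _
  obtain ⟨m, ⟨ξ, hξ⟩, η, hη⟩ := ((ha.eventually_exists_norm_sub_lt hj hδ).and
    (hb.eventually_exists_norm_sub_lt hj hδ)).exists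
  obtain ⟨p, hp⟩ := ((hmul m ξ η).eventually_lt_const hδ).exists
  have hbound : ∀ n, ‖j n p (j p m ξ * j p m η) - j n m ξ * j n m η‖
      ≤ ‖j p m ξ * j p m η‖ + ‖ξ‖ * ‖η‖ := fun n =>
    (norm_sub_le _ _).trans (add_le_add (hj.norm_map_le n p _) ((norm_mul_le _ _).trans
      (mul_le_mul (hj.norm_map_le n m ξ) (hj.norm_map_le n m η) (norm_nonneg _)
        (norm_nonneg _))))
  refine ⟨p, j p m ξ * j p m η, ?_⟩
  filter_upwards [hξ, hη, eventually_norm_lt_of_limsup_lt hbound hp] with n h₁ h₂ h₃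
  have hξC : ‖j n m ξ‖ ≤ C + 1 := by
    have := norm_le_norm_add_norm_sub (a n) (j n m ξ)
    linarith [hC n]
  have h₄ : ‖a n - j n m ξ‖ * ‖b n‖ ≤ δ * D :=
    mul_le_mul h₁.le (hD n) (norm_nonneg _) hδ.le
  have h₅ : ‖j n m ξ‖ * ‖b n - j n m η‖ ≤ (C + 1) * δ :=
    mul_le_mul hξC h₂.le (norm_nonneg _) (by positivity)
  have h₆ := norm_mul_sub_mul_le (a n) (j n m ξ) (b n) (j n m η)
  have h₇ := norm_sub_le_norm_sub_add_norm_sub (a n * b n) (j n m ξ * j n m η)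
    (j n p (j p m ξ * j p m η))
  rw [norm_sub_rev (j n m ξ * j n m η)] at h₇
  linarith

theorem JConvergent.star {A : N → Type*} [∀ n, NormedRing (A n)] [∀ n, StarRing (A n)]
    [∀ n, NormedStarGroup (A n)] [∀ n, NormedAlgebra ℂ (A n)] [∀ n, CompleteSpace (A n)]
    {j : ∀ n m : N, A m →L[ℂ] A n} (hj : IsSoftInductiveSystem j)
    (hstar : ∀ (n m : N) (a : A m), j n m (star a) = star (j n m a))
    {a : ∀ n, A n} (ha : JConvergent j a) : JConvergent j (fun n => star (a n)) := by
  obtain ⟨C, hC⟩ := ha.1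
  refine .of_eventually ⟨C, fun n => (norm_star (a n)).trans_le (hC n)⟩ fun ε hε => ?_
  obtain ⟨m, ξ, hξ⟩ := ha.exists_eventually_norm_sub_lt hj hε
  refine ⟨m, Star.star ξ, hξ.mono fun n hn => ?_⟩
  rwa [hstar, ← star_sub, norm_star]

/-- Products of uniformly bounded nets respect null perturbations of the factors. -/
theorem IsNullNet.mul_sub_mul {A : N → Type*} [∀ n, NormedRing (A n)]
    {a a' b b' : ∀ n, A n} (ha' : UniformlyBounded a') (hb : UniformlyBounded b)
    (haa' : IsNullNet (a - a')) (hbb' : IsNullNet (b - b')) :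
    IsNullNet (fun n => a n * b n - a' n * b' n) := by
  obtain ⟨C, hC⟩ := ha'
  obtain ⟨D, hD⟩ := hb
  have hlim := (Tendsto.mul_const D haa').add (Tendsto.const_mul C hbb')
  rw [zero_mul, mul_zero, add_zero] at hlim
  refine squeeze_zero (fun _ => norm_nonneg _) (fun n => ?_) hlim
  exact (norm_mul_sub_mul_le (a n) (a' n) (b n) (b' n)).trans (add_le_add
    (mul_le_mul_of_nonneg_left (hD n) (norm_nonneg _))
    (mul_le_mul_of_nonneg_right (hC n) (norm_nonneg _)))

/-- In a soft inductive system of C*-algebras (connecting maps are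
star-preserving linear contractions satisfying the asymptotic homomorphism
property), adjoints and products of `j`-convergent nets are `j`-convergent, and the
`j`-limits of adjoints and products depend only on the `j`-limits of the factors
(i.e. they are unchanged by perturbations by null nets). -/
theorem cstar_limits_star_mul
    {A : N → Type*} [∀ n, NormedRing (A n)] [∀ n, StarRing (A n)]
    [∀ n, CStarRing (A n)] [∀ n, NormedAlgebra ℂ (A n)] [∀ n, StarModule ℂ (A n)]
    [∀ n, CompleteSpace (A n)]
    (j : ∀ n m : N, A m →L[ℂ] A n)
    (hj : IsSoftInductiveSystem j)
    (hstar : ∀ (n m : N) (a : A m), j n m (star a) = star (j n m a))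
    (hmul : ∀ (l : N) (a b : A l),
      Tendsto (fun m => limsup
          (fun n => ‖j n m (j m l a * j m l b) - j n l a * j n l b‖) atTop)
        atTop (𝓝 0)) :
    (∀ a : ∀ n, A n, JConvergent j a → JConvergent j (fun n => star (a n))) ∧
    (∀ a b : ∀ n, A n, JConvergent j a → JConvergent j b →
      JConvergent j (fun n => a n * b n)) ∧
    (∀ a a' : ∀ n, A n, JConvergent j a → JConvergent j a' →
      IsNullNet (a - a') →
      IsNullNet (fun n => star (a n) - star (a' n))) ∧
    (∀ a a' b b' : ∀ n, A n, JConvergent j a → JConvergent j a' →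
      JConvergent j b → JConvergent j b' →
      IsNullNet (a - a') → IsNullNet (b - b') →
      IsNullNet (fun n => a n * b n - a' n * b' n)) := by
  refine ⟨fun a ha => ha.star hj hstar, fun a b ha hb => ha.mul hj hmul hb,
    fun a a' _ _ h => ?_, fun a a' b b' _ ha' hb _ => IsNullNet.mul_sub_mul ha'.1 hb.1⟩
  refine Tendsto.congr (fun n => ?_) h
  simp only [← star_sub, norm_star, Pi.sub_apply]
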